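/- arXiv:2602.18686 — 5 statements merged into one kernel-verified Lean document; each statement's English description precedes it below -/
import Mathlib

section
/- Let I be an open interval and P₁₁, P₁₂, P₂₁, P₂₂ : I → ℝ smooth functions. Set p₁ = (P₁₁, P₁₂) and p₂ = (P₂₁, P₂₂), and assume det(p₂(ξ); p₂'(ξ)) ≠ 0 for all ξ ∈ I. Then the map β = (β₁, β₂, β₃, β₄) : I → ℝ⁴ defined by β(ξ) = (1/(4·det(p₂(ξ); p₂'(ξ)))) · (φ(p₁, p₂)(ξ), φ(p₁E, p₂L)(ξ), φ(p₁E, p₂)(ξ), φ(p₁, p₂L)(ξ)) is a null curve in E⁴₂. -/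
/-- `phiR x1 x2 y1 y2` is the map `φ(x,y)(ξ) = −det(x(ξ); y'(ξ)) + det(x'(ξ); y(ξ))`
for the row-vector valued maps `x = (x1, x2)` and `y = (y1, y2)`. -/
noncomputable def phiR (x1 x2 y1 y2 : ℝ → ℝ) (ξ : ℝ) : ℝ :=
  -(x1 ξ * deriv y2 ξ - x2 ξ * deriv y1 ξ) + (deriv x1 ξ * y2 ξ - deriv x2 ξ * y1 ξ)

theorem ContDiffOn.hasDerivAt_deriv_and_deriv_deriv {I : Set ℝ} (hI : IsOpen I) {f : ℝ → ℝ}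
    (hf : ContDiffOn ℝ (⊤ : ℕ∞) f I) {ξ : ℝ} (hξ : ξ ∈ I) :
    HasDerivAt f (deriv f ξ) ξ ∧ HasDerivAt (deriv f) (deriv (deriv f) ξ) ξ := by
  have hf' : ContDiffOn ℝ (⊤ : ℕ∞) (deriv f) I := hf.deriv_of_isOpen hI le_rfl
  exact ⟨((hf.differentiableOn (by simp)).differentiableAt (hI.mem_nhds hξ)).hasDerivAt,
    ((hf'.differentiableOn (by simp)).differentiableAt (hI.mem_nhds hξ)).hasDerivAt⟩

theorem hasDerivAt_phiR {x1 x2 y1 y2 : ℝ → ℝ} {ξ a b c d : ℝ}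
    (hx1 : HasDerivAt x1 (deriv x1 ξ) ξ) (hx1' : HasDerivAt (deriv x1) a ξ)
    (hx2 : HasDerivAt x2 (deriv x2 ξ) ξ) (hx2' : HasDerivAt (deriv x2) b ξ)
    (hy1 : HasDerivAt y1 (deriv y1 ξ) ξ) (hy1' : HasDerivAt (deriv y1) c ξ)
    (hy2 : HasDerivAt y2 (deriv y2 ξ) ξ) (hy2' : HasDerivAt (deriv y2) d ξ) :
    HasDerivAt (phiR x1 x2 y1 y2) (-(x1 ξ * d - x2 ξ * c) + (a * y2 ξ - b * y1 ξ)) ξ := by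
  refine (((hx1.mul hy2').sub (hx2.mul hy1')).neg.add
    ((hx1'.mul hy2).sub (hx2'.mul hy1))).congr_deriv ?_
  ring

/-- The representation formula produces a null curve in `E⁴₂`:
with `p₁ = (P₁₁, P₁₂)`, `p₂ = (P₂₁, P₂₂)` smooth on an open interval `I` and
`det(p₂; p₂') ≠ 0` on `I`, the curve
`β = (φ(p₁,p₂), φ(p₁E,p₂L), φ(p₁E,p₂), φ(p₁,p₂L)) / (4 det(p₂;p₂'))`
satisfies `⟨β', β'⟩ = 0` on `I`.  Here `p₁E = (P₁₁, −P₁₂)` and `p₂L = (P₂₂, P₂₁)`. -/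
theorem stmt0 (I : Set ℝ) (hI : IsOpen I) (hIc : I.OrdConnected)
    (P11 P12 P21 P22 : ℝ → ℝ)
    (h11 : ContDiffOn ℝ (⊤ : ℕ∞) P11 I) (h12 : ContDiffOn ℝ (⊤ : ℕ∞) P12 I)
    (h21 : ContDiffOn ℝ (⊤ : ℕ∞) P21 I) (h22 : ContDiffOn ℝ (⊤ : ℕ∞) P22 I)
    (hdet : ∀ ξ ∈ I, P21 ξ * deriv P22 ξ - P22 ξ * deriv P21 ξ ≠ 0) :
    ∀ ξ ∈ I,
      (deriv (fun t => phiR P11 P12 P21 P22 t /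
        (4 * (P21 t * deriv P22 t - P22 t * deriv P21 t))) ξ) ^ 2 +
      (deriv (fun t => phiR P11 (fun u => -P12 u) P22 P21 t /
        (4 * (P21 t * deriv P22 t - P22 t * deriv P21 t))) ξ) ^ 2 -
      (deriv (fun t => phiR P11 (fun u => -P12 u) P21 P22 t /
        (4 * (P21 t * deriv P22 t - P22 t * deriv P21 t))) ξ) ^ 2 -
      (deriv (fun t => phiR P11 P12 P22 P21 t /
        (4 * (P21 t * deriv P22 t - P22 t * deriv P21 t))) ξ) ^ 2 = 0 := by
  intro ξ hξ
  obtain ⟨a, a'⟩ := h11.hasDerivAt_deriv_and_deriv_deriv hI hξ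
  obtain ⟨b, b'⟩ := h12.hasDerivAt_deriv_and_deriv_deriv hI hξ
  obtain ⟨c, c'⟩ := h21.hasDerivAt_deriv_and_deriv_deriv hI hξ
  obtain ⟨d, d'⟩ := h22.hasDerivAt_deriv_and_deriv_deriv hI hξ
  have hn : deriv (fun u => -P12 u) = fun u => -deriv P12 u := by
    funext u
    exact deriv.fun_neg
  have e : HasDerivAt (fun u => -P12 u) (deriv (fun u => -P12 u) ξ) ξ := by
    rw [hn]
    exact b.fun_neg
  have e' : HasDerivAt (deriv (fun u => -P12 u)) (-deriv (deriv P12) ξ) ξ := by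
    rw [hn]
    exact b'.fun_neg
  have hD := ((c.fun_mul d').fun_sub (d.fun_mul c')).const_mul 4
  have h0 := hdet ξ hξ
  have h4 : 4 * (P21 ξ * deriv P22 ξ - P22 ξ * deriv P21 ξ) ≠ 0 := mul_ne_zero four_ne_zero h0
  rw [((hasDerivAt_phiR a a' b b' c c' d d').fun_div hD h4).deriv,
    ((hasDerivAt_phiR a a' e e' d d' c c').fun_div hD h4).deriv,
    ((hasDerivAt_phiR a a' e e' c c' d d').fun_div hD h4).deriv,
    ((hasDerivAt_phiR a a' b b' d d' c c').fun_div hD h4).deriv]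
  simp only [phiR, hn, div_pow, ← add_div, ← sub_div]
  rw [div_eq_zero_iff]
  left
  ring
end

section
/- Let I be an open interval, β = (β₁, β₂, β₃, β₄) : I → E⁴₂ a null curve, and k : I → ℝ a smooth function. Define P₁₁ = −2{(β₁ − β₃)(β₂' + β₄') − (β₂ + β₄)(β₁' − β₃')}·k, P₁₂ = −2{(β₂ − β₄)(β₂' + β₄') + (β₁ + β₃)(β₁' − β₃')}·k, P₂₁ = (β₂' + β₄')·k, P₂₂ = (β₁' − β₃')·k. Then for all ξ ∈ I: −det((P₁₁(ξ), P₁₂(ξ)); (P₂₁'(ξ), P₂₂'(ξ))) + det((P₁₁'(ξ), P₁₂'(ξ)); (P₂₁(ξ), P₂₂(ξ))) = 4·β₁(ξ)·det((P₂₁(ξ), P₂₂(ξ)); (P₂₁'(ξ), P₂₂'(ξ))). -/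
/-- The derivative of a function smooth on an open set is differentiable there. -/
theorem differentiableAt_deriv_of_contDiffOn {I : Set ℝ} (hI : IsOpen I) {f : ℝ → ℝ}
    (hf : ContDiffOn ℝ (⊤ : ℕ∞) f I) {x : ℝ} (hx : x ∈ I) :
    DifferentiableAt ℝ (deriv f) x :=
  (((contDiffOn_infty.1 hf 2).deriv_of_isOpen (m := 1) hI
    (by norm_num)).contDiffAt
      (hI.mem_nhds hx)).differentiableAt (by norm_num)

/-- For a null curve `β` in `E⁴₂` and the associated data
`P₁₁, P₁₂, P₂₁, P₂₂`, one has
`−det((P₁₁,P₁₂);(P₂₁',P₂₂')) + det((P₁₁',P₁₂');(P₂₁,P₂₂)) = 4·β₁·det((P₂₁,P₂₂);(P₂₁',P₂₂'))`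
on `I`, where `det((a₁,a₂);(b₁,b₂)) = a₁b₂ − a₂b₁`. -/
theorem stmt10 (I : Set ℝ) (hI : IsOpen I) (hIc : I.OrdConnected)
    (β1 β2 β3 β4 k : ℝ → ℝ)
    (hβ1 : ContDiffOn ℝ (⊤ : ℕ∞) β1 I) (hβ2 : ContDiffOn ℝ (⊤ : ℕ∞) β2 I)
    (hβ3 : ContDiffOn ℝ (⊤ : ℕ∞) β3 I) (hβ4 : ContDiffOn ℝ (⊤ : ℕ∞) β4 I)
    (hk : ContDiffOn ℝ (⊤ : ℕ∞) k I)
    (hnull : ∀ ξ ∈ I,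
      (deriv β1 ξ) ^ 2 + (deriv β2 ξ) ^ 2 - (deriv β3 ξ) ^ 2 - (deriv β4 ξ) ^ 2 = 0)
    (P11 P12 P21 P22 : ℝ → ℝ)
    (hP11 : P11 = fun ξ => -2 * ((β1 ξ - β3 ξ) * (deriv β2 ξ + deriv β4 ξ) -
      (β2 ξ + β4 ξ) * (deriv β1 ξ - deriv β3 ξ)) * k ξ)
    (hP12 : P12 = fun ξ => -2 * ((β2 ξ - β4 ξ) * (deriv β2 ξ + deriv β4 ξ) +
      (β1 ξ + β3 ξ) * (deriv β1 ξ - deriv β3 ξ)) * k ξ)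
    (hP21 : P21 = fun ξ => (deriv β2 ξ + deriv β4 ξ) * k ξ)
    (hP22 : P22 = fun ξ => (deriv β1 ξ - deriv β3 ξ) * k ξ) :
    ∀ ξ ∈ I,
      -(P11 ξ * deriv P22 ξ - P12 ξ * deriv P21 ξ) +
        (deriv P11 ξ * P22 ξ - deriv P12 ξ * P21 ξ) =
      4 * β1 ξ * (P21 ξ * deriv P22 ξ - P22 ξ * deriv P21 ξ) := by
  intro ξ hξ
  have hd : ∀ {f : ℝ → ℝ}, ContDiffOn ℝ (⊤ : ℕ∞) f I → HasDerivAt f (deriv f ξ) ξ :=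
    fun hf => ((hf.contDiffAt (hI.mem_nhds hξ)).differentiableAt (by simp)).hasDerivAt
  have hdd : ∀ {f : ℝ → ℝ}, ContDiffOn ℝ (⊤ : ℕ∞) f I →
      HasDerivAt (deriv f) (deriv (deriv f) ξ) ξ :=
    fun hf => (differentiableAt_deriv_of_contDiffOn hI hf hξ).hasDerivAt
  subst hP11 hP12 hP21 hP22
  have d21 := (((hdd hβ2).fun_add (hdd hβ4)).fun_mul (hd hk)).deriv
  have d22 := (((hdd hβ1).fun_sub (hdd hβ3)).fun_mul (hd hk)).deriv
  have d11 := ((((((hd hβ1).fun_sub (hd hβ3)).fun_mul ((hdd hβ2).fun_add (hdd hβ4))).fun_sub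
    (((hd hβ2).fun_add (hd hβ4)).fun_mul ((hdd hβ1).fun_sub (hdd hβ3)))).const_mul
      (-2)).fun_mul (hd hk)).deriv
  have d12 := ((((((hd hβ2).fun_sub (hd hβ4)).fun_mul ((hdd hβ2).fun_add (hdd hβ4))).fun_add
    (((hd hβ1).fun_add (hd hβ3)).fun_mul ((hdd hβ1).fun_sub (hdd hβ3)))).const_mul
      (-2)).fun_mul (hd hk)).deriv
  rw [d11, d12, d21, d22]
  linear_combination (2 * k ξ ^ 2 * (deriv β2 ξ + deriv β4 ξ)) * hnull ξ hξ
end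

section
/- Let p, q ∈ ℝ with q ≠ 0. Then the curve α₂ : ℝ → ℝ⁴ defined by α₂(ξ) = (1/(4q)) · ( −(p+q)cos((p−q)ξ), −(p+q)sin((p−q)ξ), (p−q)cos((p+q)ξ), −(p−q)sin((p+q)ξ) ) is a null curve in E⁴₂. -/
theorem hasDerivAt_cos_const_mul (a ξ : ℝ) :
    HasDerivAt (fun t => Real.cos (a * t)) (-(a * Real.sin (a * ξ))) ξ := by
  simpa [mul_comm] using ((hasDerivAt_id ξ).const_mul a).cos

theorem hasDerivAt_sin_const_mul (a ξ : ℝ) :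
    HasDerivAt (fun t => Real.sin (a * t)) (a * Real.cos (a * ξ)) ξ := by
  simpa [mul_comm] using ((hasDerivAt_id ξ).const_mul a).sin


/-- The curve
`α₂(ξ) = (1/(4q))·(−(p+q)cos((p−q)ξ), −(p+q)sin((p−q)ξ), (p−q)cos((p+q)ξ), −(p−q)sin((p+q)ξ))`
is a null curve in `E⁴₂`. -/
theorem stmt15 (p q : ℝ) (hq : q ≠ 0) :
    ∀ ξ : ℝ,
      (deriv (fun t => -((p + q) * Real.cos ((p - q) * t)) / (4 * q)) ξ) ^ 2 +
      (deriv (fun t => -((p + q) * Real.sin ((p - q) * t)) / (4 * q)) ξ) ^ 2 -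
      (deriv (fun t => (p - q) * Real.cos ((p + q) * t) / (4 * q)) ξ) ^ 2 -
      (deriv (fun t => -((p - q) * Real.sin ((p + q) * t)) / (4 * q)) ξ) ^ 2 = 0 := by
  intro ξ
  rw [(((hasDerivAt_cos_const_mul (p - q) ξ).const_mul (p + q)).fun_neg.div_const (4 * q)).deriv,
    (((hasDerivAt_sin_const_mul (p - q) ξ).const_mul (p + q)).fun_neg.div_const (4 * q)).deriv,
    (((hasDerivAt_cos_const_mul (p + q) ξ).const_mul (p - q)).div_const (4 * q)).deriv,
    (((hasDerivAt_sin_const_mul (p + q) ξ).const_mul (p - q)).fun_neg.div_const (4 * q)).deriv]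
  linear_combination ((p + q) * (p - q) / (4 * q)) ^ 2 *
    (Real.sin_sq_add_cos_sq ((p - q) * ξ) - Real.sin_sq_add_cos_sq ((p + q) * ξ))
end

section
/- Let q, r, s ∈ ℝ with r ≠ s and q + s − 2r ≠ 0. Define α₃ : ℝ → ℝ³ by α₃(ξ) = (1/4)·(α₁₃(ξ), α₂₃(ξ), α₃₃(ξ)), where α₁₃(ξ) = ((q−s)(q−r)/((q+s−2r)(s−r)))e^{(q+s−2r)ξ} + (q−s)/(q+s−2r) + ((r−q)/(s−r))e^{(q−s)ξ}, α₂₃(ξ) = (2(q−s)/(s−r))e^{(q−r)ξ}, and α₃₃(ξ) = ((q−s)(q−r)/((q+s−2r)(s−r)))e^{(q+s−2r)ξ} + (q−s)/(q+s−2r) − ((r−q)/(s−r))e^{(q−s)ξ}. Then α₃ is a null curve in E³₁. -/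
/-- The exponential `t ↦ exp (a * t)` has derivative `a * exp (a * x)` at `x`. -/
theorem hasDerivAt_exp_const_mul (a x : ℝ) :
    HasDerivAt (fun t => Real.exp (a * t)) (a * Real.exp (a * x)) x := by
  simpa [mul_comm] using ((hasDerivAt_id x).const_mul a).exp

/-- The curve `α₃ = (1/4)·(α₁₃, α₂₃, α₃₃)` with
`α₁₃(ξ) = ((q−s)(q−r)/((q+s−2r)(s−r)))e^{(q+s−2r)ξ} + (q−s)/(q+s−2r) + ((r−q)/(s−r))e^{(q−s)ξ}`,
`α₂₃(ξ) = (2(q−s)/(s−r))e^{(q−r)ξ}`,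
`α₃₃(ξ) = ((q−s)(q−r)/((q+s−2r)(s−r)))e^{(q+s−2r)ξ} + (q−s)/(q+s−2r) − ((r−q)/(s−r))e^{(q−s)ξ}`
is a null curve in `E³₁`. -/
theorem stmt16 (q r s : ℝ) (hrs : r ≠ s) (h2r : q + s - 2 * r ≠ 0) :
    ∀ ξ : ℝ,
      (deriv (fun t => (1 / 4) *
        ((q - s) * (q - r) / ((q + s - 2 * r) * (s - r)) * Real.exp ((q + s - 2 * r) * t) +
          (q - s) / (q + s - 2 * r) + (r - q) / (s - r) * Real.exp ((q - s) * t))) ξ) ^ 2 +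
      (deriv (fun t => (1 / 4) *
        (2 * (q - s) / (s - r) * Real.exp ((q - r) * t))) ξ) ^ 2 -
      (deriv (fun t => (1 / 4) *
        ((q - s) * (q - r) / ((q + s - 2 * r) * (s - r)) * Real.exp ((q + s - 2 * r) * t) +
          (q - s) / (q + s - 2 * r) - (r - q) / (s - r) * Real.exp ((q - s) * t))) ξ) ^ 2 = 0 := by
  intro ξ
  have hsr : s - r ≠ 0 := sub_ne_zero.mpr hrs.symm
  have h₁ := ((hasDerivAt_exp_const_mul (q + s - 2 * r) ξ).const_mul
    ((q - s) * (q - r) / ((q + s - 2 * r) * (s - r)))).add_const ((q - s) / (q + s - 2 * r))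
  have h₂ := (hasDerivAt_exp_const_mul (q - r) ξ).const_mul (2 * (q - s) / (s - r))
  have h₃ := (hasDerivAt_exp_const_mul (q - s) ξ).const_mul ((r - q) / (s - r))
  have hexp : Real.exp ((q + s - 2 * r) * ξ) * Real.exp ((q - s) * ξ) =
      Real.exp ((q - r) * ξ) ^ 2 := by
    rw [← Real.exp_add, ← Real.exp_nat_mul]
    congr 1
    push_cast
    ring
  have e₁ := ((h₁.add h₃).const_mul (1 / 4)).deriv
  have e₂ := (h₂.const_mul (1 / 4)).deriv
  have e₃ := ((h₁.sub h₃).const_mul (1 / 4)).deriv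
  simp only [Pi.add_apply, Pi.sub_apply] at e₁ e₃
  rw [e₁, e₂, e₃]
  generalize Real.exp ((q + s - 2 * r) * ξ) = x at hexp ⊢
  generalize q + s - 2 * r = d at h2r ⊢
  field_simp
  linear_combination (-4 * (q - s) ^ 2 * (q - r) ^ 2) * hexp
end

section
/- Define α₅, α̃₅ : ℝ → ℝ³ by α₅(ξ) = ( −1 + (3/2)cos ξ − cos³ξ, −sin³ξ, (3/2)cos ξ − 1 ) and α̃₅(ξ) = ( sin³ξ, −1 + (3/2)cos ξ − cos³ξ, (3/2)cos ξ − 1 ). Then the map f₅ : ℝ² → E³₁, f₅(ξ₁, ξ₂) = α₅(ξ₁) + α̃₅(ξ₂), satisfies ⟨∂f₅/∂ξ₁, ∂f₅/∂ξ₁⟩ = ⟨∂f₅/∂ξ₂, ∂f₅/∂ξ₂⟩ = 0 and ∂²f₅/∂ξ₁∂ξ₂ = 0 on ℝ², i.e. f₅ is a minimal timelike surface on ℝ². -/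
/-- The curve `α₅(ξ) = (−1 + (3/2)cos ξ − cos³ξ, −sin³ξ, (3/2)cos ξ − 1)`. -/
noncomputable def alpha5 (ξ : ℝ) : Fin 3 → ℝ :=
  ![-1 + (3 / 2) * Real.cos ξ - (Real.cos ξ) ^ 3, -(Real.sin ξ) ^ 3,
    (3 / 2) * Real.cos ξ - 1]

/-- The curve `α̃₅(ξ) = (sin³ξ, −1 + (3/2)cos ξ − cos³ξ, (3/2)cos ξ − 1)`. -/
noncomputable def alphaTilde5 (ξ : ℝ) : Fin 3 → ℝ :=
  ![(Real.sin ξ) ^ 3, -1 + (3 / 2) * Real.cos ξ - (Real.cos ξ) ^ 3,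
    (3 / 2) * Real.cos ξ - 1]

theorem hasDerivAt_alpha5 (x : ℝ) :
    HasDerivAt alpha5
      ![-(3 / 2) * Real.sin x + 3 * Real.cos x ^ 2 * Real.sin x,
        -(3 * Real.sin x ^ 2 * Real.cos x), -(3 / 2) * Real.sin x] x := by
  have hc := Real.hasDerivAt_cos x
  have hs := Real.hasDerivAt_sin x
  rw [hasDerivAt_pi]
  intro i
  fin_cases i
  · exact (((hc.const_mul (3 / 2)).const_add (-1)).sub (hc.pow 3)).congr_deriv (by simp)
  · exact ((hs.pow 3).neg).congr_deriv (by simp)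
  · exact ((hc.const_mul (3 / 2)).sub_const 1).congr_deriv (by simp)

theorem hasDerivAt_alphaTilde5 (x : ℝ) :
    HasDerivAt alphaTilde5
      ![3 * Real.sin x ^ 2 * Real.cos x,
        -(3 / 2) * Real.sin x + 3 * Real.cos x ^ 2 * Real.sin x, -(3 / 2) * Real.sin x] x := by
  have hc := Real.hasDerivAt_cos x
  have hs := Real.hasDerivAt_sin x
  rw [hasDerivAt_pi]
  intro i
  fin_cases i
  · exact (hs.pow 3).congr_deriv (by simp)
  · exact (((hc.const_mul (3 / 2)).const_add (-1)).sub (hc.pow 3)).congr_deriv (by simp)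
  · exact ((hc.const_mul (3 / 2)).sub_const 1).congr_deriv (by simp)

/-- The map `f₅(ξ₁, ξ₂) = α₅(ξ₁) + α̃₅(ξ₂)` is a minimal
timelike surface on `ℝ²`: both partial derivatives are null in `E³₁` and the
mixed second partial derivative vanishes. -/
theorem stmt18 (f : ℝ → ℝ → (Fin 3 → ℝ))
    (hf : ∀ ξ₁ ξ₂, f ξ₁ ξ₂ = alpha5 ξ₁ + alphaTilde5 ξ₂) :
    ∀ ξ₁ ξ₂ : ℝ,
      ((deriv (fun t => f t ξ₂) ξ₁ 0) ^ 2 + (deriv (fun t => f t ξ₂) ξ₁ 1) ^ 2 -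
        (deriv (fun t => f t ξ₂) ξ₁ 2) ^ 2 = 0) ∧
      ((deriv (fun s => f ξ₁ s) ξ₂ 0) ^ 2 + (deriv (fun s => f ξ₁ s) ξ₂ 1) ^ 2 -
        (deriv (fun s => f ξ₁ s) ξ₂ 2) ^ 2 = 0) ∧
      deriv (fun s => deriv (fun t => f t s) ξ₁) ξ₂ = 0 := by
  intro ξ₁ ξ₂
  have h₁ (s : ℝ) := ((hasDerivAt_alpha5 ξ₁).add_const (alphaTilde5 s)).deriv
  have h₂ := ((hasDerivAt_alphaTilde5 ξ₂).const_add (alpha5 ξ₁)).deriv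
  simp only [hf, h₁, h₂, deriv_const, and_true]
  have hs₁ := Real.sin_sq ξ₁
  have hs₂ := Real.sin_sq ξ₂
  simp only [Matrix.cons_val]
  constructor
  · linear_combination 9 * Real.sin ξ₁ ^ 2 * Real.cos ξ₁ ^ 2 * hs₁
  · linear_combination 9 * Real.sin ξ₂ ^ 2 * Real.cos ξ₂ ^ 2 * hs₂
end
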